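/- Let A and B be differential operators on a differential superalgebra V of order at most N. Then A(z)·ι_z(z-w-λ-∂)^{-1}(B(w)) - A(∂+λ+w)·ι_z(z-w-λ-∂)^{-1}(B*(λ-z)) = ( A(z)(z-w-λ-∂)^{-1}B(∂+w) - A(∂+λ+w)(z-w-λ-∂)^{-1}B*(λ-z) )(1), where (·)(1) denotes applying the pseudo-differential operator to the constant 1 (i.e., taking the constant coefficient). -/

import Mathlib

noncomputable section

/-- A differential superalgebra: a `ℤ/2`-graded associative unital `ℂ`-algebra,
supercommutative, with an even derivation `D`. -/
class DiffSuperAlg (V : Type*) extends Ring V, Algebra ℂ V where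
  grading : ZMod 2 → Submodule ℂ V
  gradedAlgebra : GradedAlgebra grading
  D : V → V
  superComm : ∀ (i j : ZMod 2), ∀ a ∈ grading i, ∀ b ∈ grading j,
      a * b = ((-1 : ℂ) ^ (i.val * j.val)) • (b * a)
  D_add : ∀ a b, D (a + b) = D a + D b
  D_smul : ∀ (c : ℂ) (a : V), D (c • a) = c • D a
  D_mul : ∀ a b, D (a * b) = D a * b + a * D b
  D_even : ∀ (i : ZMod 2), ∀ a ∈ grading i, D a ∈ grading i

namespace PDO

variable {V : Type*} [DiffSuperAlg V]

/-- Iterated derivation `∂ⁿ`. -/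
def Dit (n : ℕ) : V → V := (DiffSuperAlg.D (V := V))^[n]

/-- Generalized binomial coefficient `C(k, n)` for `k ∈ ℤ`. -/
def cchoose (k : ℤ) (n : ℕ) : ℂ :=
  (∏ i ∈ Finset.range n, ((k : ℂ) - (i : ℂ))) / (n.factorial : ℂ)

/-- Sign `(-1)^x` of a parity `x ∈ ℤ/2`. -/
def sgn (x : ZMod 2) : ℂ := (-1 : ℂ) ^ x.val

/-- A formal series `Σₖ (f k) ∂ᵏ` is an honest pseudo-differential operator when its
support is bounded above. -/
def IsPDO (f : ℤ → V) : Prop := ∃ N : ℤ, ∀ k : ℤ, N < k → f k = 0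

/-- `f` is monic of order `N`. -/
def IsMonic (f : ℤ → V) (N : ℤ) : Prop :=
  f N = 1 ∧ ∀ k : ℤ, N < k → f k = 0

/-- `f` is a differential operator of order at most `N`. -/
def IsDiffOpLE (f : ℤ → V) (N : ℕ) : Prop := ∀ k : ℤ, f k ≠ 0 → 0 ≤ k ∧ k ≤ (N : ℤ)

/-- All coefficients of `f` are homogeneous of parity `π`. -/
def IsHomog (f : ℤ → V) (π : ZMod 2) : Prop :=
  ∀ k : ℤ, f k ∈ DiffSuperAlg.grading (V := V) π

/-- The product of pseudo-differential operators, obtained from the rule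
`∂ᵏ v = Σₙ C(k,n) v⁽ⁿ⁾ ∂^(k-n)`. -/
def pmul (f g : ℤ → V) : ℤ → V := fun m =>
  ∑ᶠ (k : ℤ) (j : ℤ) (n : ℕ),
    if m = k + j - (n : ℤ) then cchoose k n • (f k * Dit n (g j)) else 0

/-- The identity operator. -/
def one : ℤ → V := fun m => if m = 0 then 1 else 0

/-- The operator `∂^e`. -/
def del (e : ℤ) : ℤ → V := fun m => if m = e then 1 else 0

/-- The adjoint `A*(∂) = Σₖ (-∂)ᵏ aₖ`, coefficientwise. -/
def adj (f : ℤ → V) : ℤ → V := fun m =>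
  ∑ᶠ n : ℕ, ((-1 : ℂ) ^ (m + (n : ℤ)) * cchoose (m + n) n) • Dit n (f (m + n))

/-- The residue `Res A = a₋₁`. -/
def res (f : ℤ → V) : V := f (-1)

/-- The differential part `A₊`. -/
def dplus (f : ℤ → V) : ℤ → V := fun k => if 0 ≤ k then f k else 0

/-- Coefficient of `z^m` in `A(z+∂)(B(z))`, where `(z+∂)⁻¹` is expanded as
`Σₙ (-1)ⁿ z^(-n-1) ∂ⁿ` (i.e. via the generalized binomial coefficients). -/
def symbolSub (f g : ℤ → V) : ℤ → V := fun m =>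
  ∑ᶠ (k : ℤ) (n : ℕ), cchoose k n • (f k * Dit n (g (m - k + n)))

/-- Coefficientwise derivation on `V[λ]`. -/
def Dp (P : Polynomial V) : Polynomial V :=
  P.sum fun n c => Polynomial.C (DiffSuperAlg.D c) * Polynomial.X ^ n

/-- Iterated coefficientwise derivation on `V[λ]`. -/
def DpIt (n : ℕ) : Polynomial V → Polynomial V := (Dp (V := V))^[n]

/-- Coefficient of `w^j` in `(w+λ+∂)ⁿ (G(w))`, where `G(w) = Σ_q g_q w^q`. -/
def expW (n : ℕ) (g : ℤ → V) (j : ℤ) : Polynomial V :=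
  ∑ᶠ (m : ℕ) (α : ℕ), if m + α ≤ n then
    (((n.choose m) * ((n - m).choose α) : ℕ) : ℂ) •
      ((Polynomial.X : Polynomial V) ^ (n - m - α) * Polynomial.C (Dit m (g (j - (α : ℤ)))))
  else 0

/-- Coefficient of `z^i w^j` in `A(z) ι_z(z-w-λ-∂)⁻¹ (B(w))`. -/
def iotaTermB (f g : ℤ → V) (i j : ℤ) : Polynomial V :=
  ∑ᶠ n : ℕ, Polynomial.C (f (i + n + 1)) * expW n g j

/-- `A(w+λ+∂)` applied to `P ∈ V[λ]`: coefficient of `w^j`. -/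
def appW (f : ℤ → V) (P : Polynomial V) (j : ℤ) : Polynomial V :=
  ∑ᶠ (n : ℕ) (β : ℕ),
    (cchoose (j + n + β) n * cchoose (j + β) β) •
      ((Polynomial.X : Polynomial V) ^ β * (Polynomial.C (f (j + n + β)) * DpIt n P))

/-- Symbol of the adjoint `A*` at `λ - z` (expanded for large `|z|`):
coefficient of `z^i`, as an element of `V[λ]`. -/
def adjSymb (g : ℤ → V) (i : ℤ) : Polynomial V :=
  ∑ᶠ β : ℕ, ((-1 : ℂ) ^ i * cchoose (i + β) β) •
    ((Polynomial.X : Polynomial V) ^ β * Polynomial.C (adj g (i + β)))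

/-- Coefficient of `z^i w^j` in `A(w+λ+∂) ι_z(z-w-λ-∂)⁻¹ ((B)*(λ-z))`. -/
def iotaTermA (f g : ℤ → V) (i j : ℤ) : Polynomial V :=
  ∑ᶠ n : ℕ, appW (fun k => f (k - n)) (adjSymb g (i + n + 1)) j

/-- Coefficient of `z^i w^j` of the right-hand side
`A(w+λ+∂) ι_z(z-w-λ-∂)⁻¹ (B*)(λ-z) - A(z) ι_z(z-w-λ-∂)⁻¹ B(w)`
of the super Adler identity, for the entries `f = A_{hj}` and `g = A_{ik}`. -/
def adlerRHS (f g : ℤ → V) (i j : ℤ) : Polynomial V :=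
  iotaTermA f g i j - iotaTermB f g i j

/-- Coefficient of `w^j` in `A(w+λ)`. -/
def symbLam (f : ℤ → V) (j : ℤ) : Polynomial V :=
  ∑ᶠ β : ℕ, cchoose (j + β) β •
    ((Polynomial.X : Polynomial V) ^ β * Polynomial.C (f (j + β)))

variable {I : Type*} [Fintype I] [DecidableEq I]

/-- The super Adler-type operator property of a matrix pseudo-differential operator,
with respect to a λ-bracket `Br` and the parity function `p` on the index set. -/
def IsSATO (p : I → ZMod 2) (Br : V → V → Polynomial V) (A : I → I → ℤ → V) : Prop :=
  ∀ i j h k : I, ∀ zp wp : ℤ,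
    Br (A i j zp) (A h k wp) =
      sgn (p i * p j + p i * p h + p j * p h) • adlerRHS (A h j) (A i k) zp wp

/-- Homogeneous component of parity `π` of an element of `V`. -/
def gpart (π : ZMod 2) (v : V) : V :=
  letI := DiffSuperAlg.gradedAlgebra (V := V)
  ((DirectSum.decompose (DiffSuperAlg.grading (V := V)) v) π : V)

/-- The `∘`-product `(a⊗v)∘(b⊗w) = (-1)^(|b||v|) ab⊗vw` on matrix pseudo-differential
operators. -/
def circMul (p : I → ZMod 2) (M N : I → I → ℤ → V) : I → I → ℤ → V :=
  fun i j m => ∑ t : I, ∑ π : ZMod 2,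
    sgn ((p t + p j) * π) • pmul (fun k => gpart π (M i t k)) (N t j) m

/-- The `⋆`-product `(a⊗v)⋆(b⊗w) = (-1)^(|b||v|+|a||b|) ab⊗vw` on matrix
pseudo-differential operators. -/
def starMul (p : I → ZMod 2) (M N : I → I → ℤ → V) : I → I → ℤ → V :=
  fun i j m => ∑ t : I, ∑ π : ZMod 2,
    sgn ((p t + p j) * π + (p i + p t) * (p t + p j)) •
      pmul (fun k => gpart π (M i t k)) (N t j) m

/-- The identity matrix operator `𝟙_I`. -/
def idMat : I → I → ℤ → V := fun i j m => if i = j ∧ m = 0 then 1 else 0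

/-- `M` is a monic matrix (pseudo-)differential operator of order `N`. -/
def IsMonicMat (M : I → I → ℤ → V) (N : ℤ) : Prop :=
  (∀ i j : I, M i j N = if i = j then (1 : V) else 0) ∧
  (∀ i j : I, ∀ k : ℤ, N < k → M i j k = 0)

/-- `∘`-powers of a matrix pseudo-differential operator. -/
def circPow (p : I → ZMod 2) (M : I → I → ℤ → V) : ℕ → I → I → ℤ → V
  | 0 => idMat
  | n + 1 => circMul p M (circPow p M n)

/-- Matrix-wise differential part. -/
def dplusMat (M : I → I → ℤ → V) : I → I → ℤ → V := fun i j => dplus (M i j)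

/-- `Res str M`, the supertrace of the residue. -/
def strRes (p : I → ZMod 2) (M : I → I → ℤ → V) : V :=
  ∑ i : I, sgn (p i) • res (M i i)

/-- `{a_(λ+∂) c}_→ b`, i.e. `Σₙ (a₍ₙ₎c) (λ+∂)ⁿ b` for `P = {a_λ c}`. -/
def lamShift (P : Polynomial V) (b : V) : Polynomial V :=
  ∑ᶠ (n : ℕ) (m : ℕ), if m ≤ n then ((n.choose m : ℕ) : ℂ) •
    ((Polynomial.X : Polynomial V) ^ (n - m) * Polynomial.C (P.coeff n * Dit m b)) else 0

/-- `{b_(-λ-∂) a}` computed from `P = {b_λ a}`. -/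
def negLam (P : Polynomial V) : Polynomial V :=
  ∑ᶠ (n : ℕ) (m : ℕ), if m ≤ n then (((n.choose m : ℕ) : ℂ) * (-1 : ℂ) ^ n) •
    ((Polynomial.X : Polynomial V) ^ (n - m) * Polynomial.C (Dit m (P.coeff n))) else 0

end PDO

/-- A λ-bracket on a differential superalgebra: even, bilinear, sesquilinear,
satisfying the left and right Leibniz rules. -/
structure LambdaBracket (V : Type*) [DiffSuperAlg V] where
  br : V → V → Polynomial V
  add_left : ∀ a b c : V, br (a + b) c = br a c + br b c
  add_right : ∀ a b c : V, br a (b + c) = br a b + br a c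
  smul_left : ∀ (r : ℂ) (a b : V), br (r • a) b = r • br a b
  smul_right : ∀ (r : ℂ) (a b : V), br a (r • b) = r • br a b
  even : ∀ (i j : ZMod 2), ∀ a ∈ DiffSuperAlg.grading (V := V) i,
      ∀ b ∈ DiffSuperAlg.grading (V := V) j, ∀ n : ℕ,
      (br a b).coeff n ∈ DiffSuperAlg.grading (V := V) (i + j)
  sesq_left : ∀ a b : V, br (DiffSuperAlg.D a) b = -(Polynomial.X * br a b)
  sesq_right : ∀ a b : V,
      br a (DiffSuperAlg.D b) = Polynomial.X * br a b + PDO.Dp (br a b)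
  leibniz_left : ∀ (i j : ZMod 2), ∀ a ∈ DiffSuperAlg.grading (V := V) i,
      ∀ b ∈ DiffSuperAlg.grading (V := V) j, ∀ c : V,
      br a (b * c) = br a b * Polynomial.C c + PDO.sgn (i * j) • (Polynomial.C b * br a c)
  leibniz_right : ∀ (i j k : ZMod 2), ∀ a ∈ DiffSuperAlg.grading (V := V) i,
      ∀ b ∈ DiffSuperAlg.grading (V := V) j, ∀ c ∈ DiffSuperAlg.grading (V := V) k,
      br (a * b) c =
        PDO.sgn (j * k) • PDO.lamShift (br a c) b +
        PDO.sgn (i * (j + k)) • PDO.lamShift (br b c) a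

namespace PDO

variable {V : Type*} [DiffSuperAlg V]

/-- Skew-symmetry axiom: `{a_λ b} = -(-1)^(|a||b|) {b_(-λ-∂) a}`. -/
def SkewSymm (B : LambdaBracket V) : Prop :=
  ∀ (i j : ZMod 2), ∀ a ∈ DiffSuperAlg.grading (V := V) i,
    ∀ b ∈ DiffSuperAlg.grading (V := V) j,
    B.br a b = -(sgn (i * j) • negLam (B.br b a))

/-- Coefficient of `λ^l μ^m` in `{{a_λ b}_(λ+μ) c}`. -/
def jacComp (B : LambdaBracket V) (a b c : V) (l m : ℕ) : V :=
  ∑ᶠ n : ℕ, if n ≤ l then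
    (((l - n + m).choose m : ℕ) : ℂ) • (B.br ((B.br a b).coeff n) c).coeff (l - n + m)
  else 0

/-- Jacobi identity: `{a_λ {b_μ c}} = {{a_λ b}_(λ+μ) c} + (-1)^(|a||b|) {b_μ {a_λ c}}`,
written on the coefficient of `λ^l μ^m`. -/
def Jacobi (B : LambdaBracket V) : Prop :=
  ∀ (i j : ZMod 2), ∀ a ∈ DiffSuperAlg.grading (V := V) i,
    ∀ b ∈ DiffSuperAlg.grading (V := V) j, ∀ c : V, ∀ l m : ℕ,
    (B.br a ((B.br b c).coeff m)).coeff l =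
      jacComp B a b c l m + sgn (i * j) • (B.br b ((B.br a c).coeff l)).coeff m

/-- The family `u` differentially generates `V`. -/
def diffGen (u : Set V) : Prop :=
  Algebra.adjoin ℂ {x : V | ∃ v ∈ u, ∃ n : ℕ, x = Dit n v} = ⊤

end PDO

namespace PDO

variable {V : Type*} [DiffSuperAlg V]

/-- Composition of operator-valued series in `z, w, ∂` with coefficients in `V[λ]`:
indices are the exponents of `z`, `w` and `∂`. -/
def omul (F G : ℤ → ℤ → ℤ → Polynomial V) : ℤ → ℤ → ℤ → Polynomial V :=
  fun i j m => ∑ᶠ (i₁ : ℤ) (j₁ : ℤ) (k : ℤ) (n : ℕ),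
    cchoose k n • (F i₁ j₁ k * DpIt n (G (i - i₁) (j - j₁) (m - k + n)))

/-- `A(z)` as an operator-valued series. -/
def symbZ (f : ℤ → V) : ℤ → ℤ → ℤ → Polynomial V :=
  fun i j m => if j = 0 ∧ m = 0 then Polynomial.C (f i) else 0

/-- `ι_z(z-w-λ-∂)⁻¹ = Σ_{n≥0} z^(-n-1) (w+λ+∂)ⁿ` as an operator-valued series. -/
def iotaZInv : ℤ → ℤ → ℤ → Polynomial V := fun i j m =>
  if i < 0 ∧ 0 ≤ j ∧ 0 ≤ m ∧ j + m ≤ -i - 1 then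
    ((((-i - 1).toNat.choose j.toNat) * (((-i - 1) - j).toNat.choose m.toNat) : ℕ) : ℂ) •
      ((Polynomial.X : Polynomial V) ^ ((-i - 1) - j - m).toNat)
  else 0

/-- `B(∂+w)` as an operator-valued series. -/
def symbWD (g : ℤ → V) : ℤ → ℤ → ℤ → Polynomial V := fun i j m =>
  if i = 0 ∧ 0 ≤ j then cchoose (j + m) j.toNat • Polynomial.C (g (j + m)) else 0

/-- `B*(λ-z)` as an operator-valued series. -/
def symbAdjLZ (g : ℤ → V) : ℤ → ℤ → ℤ → Polynomial V := fun i j m =>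
  if j = 0 ∧ m = 0 then adjSymb g i else 0

/-- `A(∂+λ+w)` as an operator-valued series. -/
def symbWLD (f : ℤ → V) : ℤ → ℤ → ℤ → Polynomial V := fun i j m =>
  if i = 0 ∧ 0 ≤ j then
    ∑ᶠ β : ℕ, (cchoose (m + β + j) β * cchoose (m + j) j.toNat) •
      ((Polynomial.X : Polynomial V) ^ β * Polynomial.C (f (m + j + β)))
  else 0

end PDO

namespace PDO

theorem finsum_inj {α β M : Type*} [AddCommMonoid M] (e : α → β) (he : Function.Injective e)
    (h : β → M) (h0 : ∀ b, (∀ a, e a ≠ b) → h b = 0) : ∑ᶠ b, h b = ∑ᶠ a, h (e a) := by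
  rw [← finsum_mem_range he, ← finsum_mem_univ]
  rw [← finsum_mem_inter_support h Set.univ, ← finsum_mem_inter_support h (Set.range e)]
  congr 1
  suffices hS : Set.univ ∩ Function.support h = Set.range e ∩ Function.support h by rw [hS]
  ext b
  simp only [Set.mem_inter_iff, Set.mem_univ, true_and, Function.mem_support, Set.mem_range]
  constructor
  · intro hb
    refine ⟨?_, hb⟩
    by_contra hc
    push Not at hc
    exact hb (h0 b hc)
  · exact fun hb => hb.2

theorem finsum_z {α M : Type*} [AddCommMonoid M] (h : α → M) (h0 : ∀ a, h a = 0) :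
    ∑ᶠ a, h a = 0 := by
  simp [h0]

theorem finsum_rng {M : Type*} [AddCommMonoid M] (h : ℕ → M) (n : ℕ)
    (h0 : ∀ k, n ≤ k → h k = 0) : ∑ᶠ k, h k = ∑ k ∈ Finset.range n, h k := by
  apply finsum_eq_sum_of_support_subset
  intro k hk
  simp only [Finset.coe_range, Set.mem_Iio]
  by_contra hc
  exact hk (h0 k (by omega))

theorem finsum_shift {M : Type*} [AddCommMonoid M] (t : ℕ → M) (c : ℕ)
    (h0 : ∀ s, s < c → t s = 0) : ∑ᶠ b, t (b + c) = ∑ᶠ s, t s := by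
  symm
  apply finsum_inj (fun b => b + c) (add_left_injective c) t
  intro s hs
  apply h0
  by_contra hc
  exact hs (s - c) (by omega)

theorem finsum_int {M : Type*} [AddCommMonoid M] (h : ℤ → M)
    (h0 : ∀ s, s < 0 → h s = 0) : ∑ᶠ b, h b = ∑ᶠ s : ℕ, h s := by
  apply finsum_inj (fun b : ℕ => (b : ℤ)) Nat.cast_injective h
  intro s hs
  apply h0
  by_contra hc
  exact hs s.toNat (by omega)

theorem cchoose_nat (s n : ℕ) : cchoose (s : ℤ) n = (s.choose n : ℂ) := by
  unfold cchoose
  have h1 : (∏ i ∈ Finset.range n, (((s : ℤ) : ℂ) - (i : ℂ))) = (s.descFactorial n : ℂ) := by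
    rw [← descPochhammer_eval_eq_descFactorial, descPochhammer_eval_eq_prod_range]
    simp
  rw [h1, Nat.descFactorial_eq_factorial_mul_choose, Nat.cast_mul]
  have : (n.factorial : ℂ) ≠ 0 := by exact_mod_cast n.factorial_ne_zero
  field_simp

theorem choose_symm2 (u a b : ℕ) :
    u.choose a * (u - a).choose b = u.choose b * (u - b).choose a := by
  by_cases h : a + b ≤ u
  · have h1 := Nat.choose_mul (n := u) (k := a + b) (s := a) (by omega)
    have h2 := Nat.choose_mul (n := u) (k := a + b) (s := b) (by omega)
    rw [Nat.add_sub_cancel_left] at h1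
    rw [Nat.add_sub_cancel] at h2
    rw [← h1, ← h2, Nat.choose_symm_add]
  · have h1 : u.choose a * (u - a).choose b = 0 := by
      by_cases ha : u < a
      · simp [Nat.choose_eq_zero_of_lt ha]
      · rw [Nat.choose_eq_zero_of_lt (n := u - a) (by omega), mul_zero]
    have h2 : u.choose b * (u - b).choose a = 0 := by
      by_cases ha : u < b
      · simp [Nat.choose_eq_zero_of_lt ha]
      · rw [Nat.choose_eq_zero_of_lt (n := u - b) (by omega), mul_zero]
    rw [h1, h2]

theorem tri_zero (u a b : ℕ) (h : u < a + b) : u.choose a * (u - a).choose b = 0 := by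
  by_cases ha : u < a
  · simp [Nat.choose_eq_zero_of_lt ha]
  · rw [Nat.choose_eq_zero_of_lt (n := u - a) (by omega), mul_zero]

theorem vander (s p k : ℕ) : ∑ a ∈ Finset.range (k + 1), s.choose a * p.choose (k - a)
    = (s + p).choose k := by
  rw [Nat.add_choose_eq, Finset.Nat.sum_antidiagonal_eq_sum_range_succ
    (fun a b => s.choose a * p.choose b)]

theorem vander2 (s p j n : ℕ) :
    ∑ a ∈ Finset.range (j + 1), ∑ k ∈ Finset.range (n + 1),
      (s.choose a * (s - a).choose k) * (p.choose (j - a) * (p - (j - a)).choose (n - k))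
    = (s + p).choose j * (s + p - j).choose n := by
  rw [← vander s p j, Finset.sum_mul]
  apply Finset.sum_congr rfl
  intro a ha
  rw [Finset.mem_range] at ha
  by_cases h1 : s < a
  · simp [Nat.choose_eq_zero_of_lt h1]
  by_cases h2 : p < j - a
  · simp [Nat.choose_eq_zero_of_lt h2]
  have : s + p - j = (s - a) + (p - (j - a)) := by omega
  rw [this, ← vander, Finset.mul_sum]
  apply Finset.sum_congr rfl
  intro k _
  ring

section

variable {V : Type*} [DiffSuperAlg V]

theorem D_zero : DiffSuperAlg.D (0 : V) = 0 := by
  have := DiffSuperAlg.D_smul (0 : ℂ) (0 : V)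
  simpa using this

theorem D_one : DiffSuperAlg.D (1 : V) = 0 := by
  have := DiffSuperAlg.D_mul (1 : V) 1
  simpa using this

theorem Dit_zero' (n : ℕ) : Dit n (0 : V) = 0 := by
  unfold Dit
  exact Function.iterate_fixed D_zero n

theorem coeff_Dp (P : Polynomial V) (n : ℕ) : (Dp P).coeff n = DiffSuperAlg.D (P.coeff n) := by
  unfold Dp
  rw [Polynomial.sum_def, Polynomial.finsetSum_coeff]
  simp only [Polynomial.coeff_C_mul_X_pow]
  rw [Finset.sum_ite_eq]
  split_ifs with h
  · rfl
  · rw [Polynomial.notMem_support_iff.mp h, D_zero]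

theorem coeff_DpIt (m : ℕ) (P : Polynomial V) (n : ℕ) :
    (DpIt m P).coeff n = Dit m (P.coeff n) := by
  unfold DpIt Dit
  induction m generalizing P with
  | zero => rfl
  | succ m ih => rw [Function.iterate_succ_apply, Function.iterate_succ_apply, ih, coeff_Dp]

theorem DpIt_zero (m : ℕ) : DpIt m (0 : Polynomial V) = 0 := by
  ext n
  simp [coeff_DpIt, Dit_zero']

theorem DpIt_C (m : ℕ) (v : V) : DpIt m (Polynomial.C v) = Polynomial.C (Dit m v) := by
  ext n
  rw [coeff_DpIt, Polynomial.coeff_C, Polynomial.coeff_C]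
  split_ifs
  · rfl
  · exact Dit_zero' m

theorem DpIt_const (m : ℕ) (hm : m ≠ 0) (c : ℂ) (a : ℕ) :
    DpIt m (c • (Polynomial.X : Polynomial V) ^ a) = 0 := by
  obtain ⟨m, rfl⟩ := Nat.exists_eq_succ_of_ne_zero hm
  have : Dp (c • (Polynomial.X : Polynomial V) ^ a) = 0 := by
    ext n
    rw [coeff_Dp, Polynomial.coeff_smul, DiffSuperAlg.D_smul, Polynomial.coeff_X_pow]
    split_ifs
    · simp [D_one]
    · simp [D_zero]
  unfold DpIt
  rw [Function.iterate_succ_apply, this]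
  exact DpIt_zero m

theorem DpIt_iota (n : ℕ) (hn : n ≠ 0) (i j m : ℤ) :
    DpIt n (iotaZInv (V := V) i j m) = 0 := by
  unfold iotaZInv
  split_ifs
  · exact DpIt_const n hn _ _
  · exact DpIt_zero n

theorem DpIt_z (P : Polynomial V) : DpIt 0 P = P := rfl

theorem cchoose_zero (k : ℤ) : cchoose k 0 = 1 := by simp [cchoose]

theorem cchoose_zero_left (n : ℕ) (hn : n ≠ 0) : cchoose 0 n = 0 := by
  have := cchoose_nat 0 n
  rw [Nat.choose_eq_zero_of_lt (by omega)] at this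
  simpa using this

theorem iota_nat (p a b : ℕ) : iotaZInv (V := V) (-(p : ℤ) - 1) a b =
    ((p.choose a * (p - a).choose b : ℕ) : ℂ) • (Polynomial.X : Polynomial V) ^ (p - a - b) := by
  unfold iotaZInv
  have h1 : (-(-(p : ℤ) - 1) - 1) = p := by ring
  rw [h1]
  split_ifs with h
  · have h2 : ((p : ℤ) - a).toNat = p - a := by omega
    have h3 : ((p : ℤ) - a - b).toNat = p - a - b := by omega
    rw [h2, h3]
    simp
  · rw [tri_zero p a b (by omega)]
    simp

theorem iota_zero (i a b : ℤ) (h : 0 ≤ i ∨ a < 0 ∨ b < 0) : iotaZInv (V := V) i a b = 0 := by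
  unfold iotaZInv
  rw [if_neg]
  omega

/-- Closed form of the coefficients of `A(w+λ+∂)(w+λ+∂)^p`. -/
def GG (f : ℤ → V) (N p j n : ℕ) : Polynomial V :=
  ∑ s ∈ Finset.range (N + 1), (((s + p).choose j * (s + p - j).choose n : ℕ) : ℂ) •
    ((Polynomial.X : Polynomial V) ^ (s + p - j - n) * Polynomial.C (f s))

theorem f_big {f : ℤ → V} {N : ℕ} (hf : IsDiffOpLE f N) (k : ℤ) (h : k < 0 ∨ (N : ℤ) < k) :
    f k = 0 := by
  by_contra hc
  have := hf k hc
  omega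

theorem symbWLD_nat {f : ℤ → V} {N : ℕ} (hf : IsDiffOpLE f N) (j k : ℕ) :
    symbWLD f 0 j k = GG f N 0 j k := by
  unfold symbWLD GG
  rw [if_pos (by omega)]
  rw [← finsum_rng (fun s : ℕ => (((s + 0).choose j * (s + 0 - j).choose k : ℕ) : ℂ) •
    ((Polynomial.X : Polynomial V) ^ (s + 0 - j - k) * Polynomial.C (f s)))]
  · rw [← finsum_shift (fun s : ℕ => (((s + 0).choose j * (s + 0 - j).choose k : ℕ) : ℂ) •
      ((Polynomial.X : Polynomial V) ^ (s + 0 - j - k) * Polynomial.C (f s))) (j + k)]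
    · apply finsum_congr
      intro b
      have e1 : (k : ℤ) + b + j = ((b + (j + k) : ℕ) : ℤ) := by push_cast; ring
      have e2 : (k : ℤ) + j = ((j + k : ℕ) : ℤ) := by push_cast; ring
      have e3 : (k : ℤ) + j + b = ((b + (j + k) : ℕ) : ℤ) := by push_cast; ring
      rw [e3, e2, e1, cchoose_nat, cchoose_nat]
      have h1 := Nat.choose_mul (n := b + (j + k)) (k := j + k) (s := j) (by omega)
      rw [Nat.add_sub_cancel_left] at h1
      have e4 : b + (j + k) + 0 - j - k = b := by omega
      rw [e4, add_zero, ← h1, Int.toNat_natCast, Nat.choose_symm_add, Nat.cast_mul]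
    · intro s hs
      rw [tri_zero _ _ _ (by omega)]
      simp
  · intro s hs
    rw [f_big hf s (by omega)]
    simp

theorem symbWLD_zero {f : ℤ → V} {N : ℕ} (hf : IsDiffOpLE f N) (i j k : ℤ)
    (h : i ≠ 0 ∨ j < 0 ∨ k < 0) : symbWLD f i j k = 0 := by
  unfold symbWLD
  split_ifs with h1
  · have hk : k < 0 := by omega
    apply finsum_z
    intro b
    by_cases h2 : k + j + b < 0
    · rw [f_big hf _ (Or.inl h2)]
      simp
    · have h3 : cchoose (k + b + j) b * cchoose (k + j) j.toNat = 0 := by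
        by_cases h4 : k + j < 0
        · obtain ⟨u, hu⟩ := Int.eq_ofNat_of_zero_le (a := k + b + j) (by omega)
          rw [hu, cchoose_nat, Nat.choose_eq_zero_of_lt (by omega)]
          simp
        · obtain ⟨u, hu⟩ := Int.eq_ofNat_of_zero_le (a := k + j) (by omega)
          rw [hu, cchoose_nat, Nat.choose_eq_zero_of_lt (by omega)]
          simp
      rw [h3, zero_smul]
  · rfl

theorem GG_mul (f : ℤ → V) (N p j n : ℕ) :
    ∑ a ∈ Finset.range (j + 1), ∑ k ∈ Finset.range (n + 1),
      GG f N 0 a k * (((p.choose (j - a) * (p - (j - a)).choose (n - k) : ℕ) : ℂ) •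
        (Polynomial.X : Polynomial V) ^ (p - (j - a) - (n - k))) = GG f N p j n := by
  unfold GG
  simp only [Finset.sum_mul]
  have : ∀ a ∈ Finset.range (j + 1), ∀ k ∈ Finset.range (n + 1), ∀ s : ℕ,
      ((((s + 0).choose a * (s + 0 - a).choose k : ℕ) : ℂ) •
        ((Polynomial.X : Polynomial V) ^ (s + 0 - a - k) * Polynomial.C (f s))) *
      (((p.choose (j - a) * (p - (j - a)).choose (n - k) : ℕ) : ℂ) •
        (Polynomial.X : Polynomial V) ^ (p - (j - a) - (n - k))) =
      (((s.choose a * (s - a).choose k) *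
        (p.choose (j - a) * (p - (j - a)).choose (n - k)) : ℕ) : ℂ) •
      ((Polynomial.X : Polynomial V) ^ (s + p - j - n) * Polynomial.C (f s)) := by
    intro a ha k hk s
    rw [Finset.mem_range] at ha hk
    by_cases h1 : s < a + k
    · rw [tri_zero s a k h1, add_zero, tri_zero s a k h1]
      simp
    by_cases h2 : p < (j - a) + (n - k)
    · rw [tri_zero p _ _ h2]
      simp
    rw [smul_mul_smul_comm, mul_assoc, ← Polynomial.X_pow_mul, ← mul_assoc, ← pow_add,
      ← Nat.cast_mul, add_zero]
    congr 3
    omega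
  rw [Finset.sum_congr rfl fun a ha => Finset.sum_congr rfl fun k hk =>
    Finset.sum_congr rfl fun s _ => this a ha k hk s]
  rw [Finset.sum_congr rfl fun a _ => Finset.sum_comm, Finset.sum_comm]
  apply Finset.sum_congr rfl
  intro s _
  rw [← vander2]
  simp only [Nat.cast_sum, Finset.sum_smul]

theorem omulA_eq {f : ℤ → V} {N : ℕ} (hf : IsDiffOpLE f N) (i j m : ℤ) :
    omul (symbWLD f) iotaZInv i j m =
      ∑ᶠ (a : ℕ) (k : ℕ), GG f N 0 a k * iotaZInv i (j - a) (m - k) := by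
  unfold omul
  rw [finsum_eq_single _ 0]
  · rw [finsum_int]
    · apply finsum_congr
      intro a
      rw [finsum_int]
      · apply finsum_congr
        intro k
        rw [finsum_eq_single _ 0]
        · rw [symbWLD_nat hf, cchoose_zero, DpIt_z]
          simp
        · intro n hn
          rw [DpIt_iota n hn]
          simp
      · intro k hk
        simp [symbWLD_zero hf 0 a k (by omega)]
    · intro a ha
      simp [symbWLD_zero hf 0 a _ (Or.inr (Or.inl ha))]
  · intro i1 hi
    simp [symbWLD_zero hf i1 _ _ (Or.inl hi)]

theorem omulA_zero {f : ℤ → V} {N : ℕ} (hf : IsDiffOpLE f N) (i j m : ℤ)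
    (h : 0 ≤ i ∨ j < 0 ∨ m < 0) : omul (symbWLD f) iotaZInv i j m = 0 := by
  rw [omulA_eq hf]
  apply finsum_z
  intro a
  apply finsum_z
  intro k
  rw [iota_zero _ _ _ (by omega), mul_zero]

theorem omulA_nat {f : ℤ → V} {N : ℕ} (hf : IsDiffOpLE f N) (p j n : ℕ) :
    omul (symbWLD f) iotaZInv (-(p : ℤ) - 1) j n = GG f N p j n := by
  rw [omulA_eq hf, ← GG_mul, finsum_rng _ (j + 1)]
  · apply Finset.sum_congr rfl
    intro a ha
    rw [Finset.mem_range] at ha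
    rw [finsum_rng _ (n + 1)]
    · apply Finset.sum_congr rfl
      intro k hk
      rw [Finset.mem_range] at hk
      rw [← iota_nat]
      congr 2 <;> omega
    · intro k hk
      rw [iota_zero _ _ _ (by omega), mul_zero]
  · intro a ha
    apply finsum_z
    intro k
    rw [iota_zero _ _ _ (by omega), mul_zero]

theorem appW_nat {f : ℤ → V} {N : ℕ} (hf : IsDiffOpLE f N) (p j : ℕ) (P : Polynomial V) :
    appW (fun k => f (k - p)) P j = ∑ᶠ n : ℕ, GG f N p j n * DpIt n P := by
  unfold appW
  apply finsum_congr
  intro n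
  unfold GG
  rw [Finset.sum_mul]
  let t : ℕ → Polynomial V := fun u => ((u.choose j * (u - j).choose n : ℕ) : ℂ) •
    ((Polynomial.X : Polynomial V) ^ (u - j - n) * Polynomial.C (f ((u : ℤ) - p))) * DpIt n P
  have h1 : ∑ᶠ b, t (b + (j + n)) = ∑ᶠ s, t (s + p) := by
    rw [finsum_shift, finsum_shift]
    · intro s hs
      simp [t, f_big hf ((s : ℤ) - p) (by omega)]
    · intro s hs
      simp only [t]
      rw [tri_zero _ _ _ hs]
      simp
  rw [finsum_rng (fun s => t (s + p)) (N + 1)] at h1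
  · trans ∑ᶠ b, t (b + (j + n))
    · apply finsum_congr
      intro b
      simp only [t]
      have e1 : (j : ℤ) + n + b = ((b + (j + n) : ℕ) : ℤ) := by push_cast; ring
      have e2 : (j : ℤ) + b = ((j + b : ℕ) : ℤ) := by push_cast; ring
      rw [e1, e2, cchoose_nat, cchoose_nat, choose_symm2, ← Nat.cast_mul]
      have e3 : b + (j + n) - j - n = b := by omega
      have e4 : b + (j + n) - n = j + b := by omega
      rw [e3, e4, smul_mul_assoc, mul_assoc, ← Nat.choose_symm_add]
    · rw [h1]
      apply Finset.sum_congr rfl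
      intro s _
      simp only [t]
      congr 6
      push_cast; ring
  · intro k hk
    simp [t, f_big hf k (by omega)]

theorem appW_zero {f : ℤ → V} {N : ℕ} (hf : IsDiffOpLE f N) (p : ℕ) (j : ℤ) (hj : j < 0)
    (P : Polynomial V) :
    appW (fun k => f (k - p)) P j = 0 := by
  unfold appW
  apply finsum_z
  intro n
  apply finsum_z
  intro b
  by_cases h2 : j + n + b < 0
  · simp [f_big hf (j + n + b - p) (by omega)]
  · have h3 : cchoose (j + n + b) n * cchoose (j + b) b = 0 := by
      by_cases h4 : j + b < 0
      · obtain ⟨u, hu⟩ := Int.eq_ofNat_of_zero_le (a := j + n + b) (by omega)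
        rw [hu, cchoose_nat, Nat.choose_eq_zero_of_lt (by omega)]
        simp
      · obtain ⟨u, hu⟩ := Int.eq_ofNat_of_zero_le (a := j + b) (by omega)
        rw [hu, cchoose_nat, Nat.choose_eq_zero_of_lt (by omega)]
        simp
    rw [h3, zero_smul]

theorem partA_rhs {f : ℤ → V} {N : ℕ} (hf : IsDiffOpLE f N) (g : ℤ → V) (i j : ℤ) :
    omul (omul (symbWLD f) iotaZInv) (symbAdjLZ g) i j 0 =
      ∑ᶠ (p : ℕ) (n : ℕ), omul (symbWLD f) iotaZInv (-(p : ℤ) - 1) j n *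
        DpIt n (adjSymb g (i + p + 1)) := by
  conv_lhs => unfold omul
  change ∑ᶠ (i₁ : ℤ) (j₁ : ℤ) (k : ℤ) (n : ℕ),
    cchoose k n • (omul (symbWLD f) iotaZInv i₁ j₁ k *
      DpIt n (symbAdjLZ g (i - i₁) (j - j₁) (0 - k + n))) = _
  rw [finsum_inj (fun p : ℕ => -(p : ℤ) - 1)]
  · apply finsum_congr
    intro p
    rw [finsum_eq_single _ j]
    · rw [finsum_int]
      · apply finsum_congr
        intro k
        rw [finsum_eq_single _ k]
        · rw [cchoose_nat, Nat.choose_self]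
          simp only [symbAdjLZ]
          rw [if_pos (by omega)]
          simp only [Nat.cast_one, one_smul]
          congr 3
          ring
        · intro n hn
          simp only [symbAdjLZ]
          rw [if_neg (by omega), DpIt_zero]
          simp
      · intro k hk
        simp [omulA_zero hf (-(p : ℤ) - 1) j k (by omega)]
    · intro j1 hj
      have : ∀ (k : ℤ), symbAdjLZ g (i - (-(p : ℤ) - 1)) (j - j1) k = 0 := by
        intro k
        simp only [symbAdjLZ]
        rw [if_neg (by omega)]
      simp [this, DpIt_zero]
  · intro a b h
    simp only at h
    omega
  · intro b hb
    have : 0 ≤ b := by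
      by_contra hc
      exact hb (-b - 1).toNat (by omega)
    simp [omulA_zero hf b _ _ (Or.inl this)]

theorem partA {f : ℤ → V} {N : ℕ} (hf : IsDiffOpLE f N) (g : ℤ → V) (i j : ℤ) :
    iotaTermA f g i j = omul (omul (symbWLD f) iotaZInv) (symbAdjLZ g) i j 0 := by
  rw [partA_rhs hf]
  unfold iotaTermA
  apply finsum_congr
  intro p
  by_cases hj : j < 0
  · rw [appW_zero hf p j hj]
    simp [omulA_zero hf _ j _ (Or.inr (Or.inl hj))]
  · obtain ⟨u, rfl⟩ := Int.eq_ofNat_of_zero_le (a := j) (by omega)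
    rw [appW_nat hf]
    simp only [omulA_nat hf]

theorem omulB_eq (f : ℤ → V) (i j m : ℤ) :
    omul (symbZ f) iotaZInv i j m =
      ∑ᶠ (n : ℕ), Polynomial.C (f (i + n + 1)) * iotaZInv (-(n : ℤ) - 1) j m := by
  unfold omul
  rw [finsum_inj (fun p : ℕ => i + p + 1)]
  · apply finsum_congr
    intro p
    rw [finsum_eq_single _ 0]
    · rw [finsum_eq_single _ 0]
      · rw [finsum_eq_single _ 0]
        · rw [cchoose_zero, DpIt_z]
          simp only [symbZ]
          simp only [and_self, if_true, one_smul]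
          congr 2 <;> ring
        · intro n hn
          rw [DpIt_iota n hn]
          simp
      · intro k hk
        simp [symbZ, hk]
    · intro a ha
      simp [symbZ, ha]
  · intro a b h
    simp only at h
    omega
  · intro b hb
    have : 0 ≤ i - b := by
      by_contra hc
      exact hb (b - i - 1).toNat (by omega)
    have h2 : ∀ (j1 k : ℤ) (n : ℕ), DpIt n (iotaZInv (V := V) (i - b) j1 k) = 0 := by
      intro j1 k n
      rw [iota_zero _ _ _ (Or.inl this), DpIt_zero]
    simp [h2]

theorem omulB_zero (f : ℤ → V) (i j m : ℤ) (h : j < 0 ∨ m < 0) :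
    omul (symbZ f) iotaZInv i j m = 0 := by
  rw [omulB_eq]
  apply finsum_z
  intro a
  rw [iota_zero _ _ _ (by omega), mul_zero]

theorem symbWD_nonpos {g : ℤ → V} {N : ℕ} (hg : IsDiffOpLE g N) (i j m : ℤ) (hm : m < 0) :
    symbWD g i j m = 0 := by
  unfold symbWD
  split_ifs with h
  · by_cases h2 : j + m < 0
    · simp [f_big hg _ (Or.inl h2)]
    · obtain ⟨u, hu⟩ := Int.eq_ofNat_of_zero_le (a := j + m) (by omega)
      rw [hu, cchoose_nat, Nat.choose_eq_zero_of_lt (by omega)]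
      simp
  · rfl

theorem symbWD_zero {g : ℤ → V} {N : ℕ} (hg : IsDiffOpLE g N) (j : ℤ) :
    symbWD g 0 j 0 = Polynomial.C (g j) := by
  unfold symbWD
  split_ifs with h
  · obtain ⟨u, hu⟩ := Int.eq_ofNat_of_zero_le (a := j) (by omega)
    rw [add_zero, hu, cchoose_nat]
    simp
  · simp [f_big hg j (by omega)]

theorem partB_rhs (f : ℤ → V) {g : ℤ → V} {N : ℕ} (hg : IsDiffOpLE g N) (i j : ℤ) :
    omul (omul (symbZ f) iotaZInv) (symbWD g) i j 0 =
      ∑ᶠ (a : ℕ) (k : ℕ), omul (symbZ f) iotaZInv i a k * Polynomial.C (Dit k (g (j - a))) := by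
  conv_lhs => unfold omul
  change ∑ᶠ (i₁ : ℤ) (j₁ : ℤ) (k : ℤ) (n : ℕ),
    cchoose k n • (omul (symbZ f) iotaZInv i₁ j₁ k *
      DpIt n (symbWD g (i - i₁) (j - j₁) (0 - k + n))) = _
  rw [finsum_eq_single _ i]
  · rw [finsum_int]
    · apply finsum_congr
      intro a
      rw [finsum_int]
      · apply finsum_congr
        intro k
        rw [finsum_eq_single _ k]
        · rw [cchoose_nat, Nat.choose_self]
          have e : (0 : ℤ) - k + k = 0 := by ring
          rw [e, sub_self, symbWD_zero hg, DpIt_C]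
          simp
        · intro n hn
          rcases lt_or_gt_of_ne hn with h | h
          · rw [symbWD_nonpos hg _ _ _ (by omega), DpIt_zero]
            simp
          · rw [cchoose_nat, Nat.choose_eq_zero_of_lt h]
            simp
      · intro k hk
        simp [omulB_zero f i a k (by omega)]
    · intro a ha
      simp [omulB_zero f i a _ (Or.inl ha)]
  · intro i1 hi
    have : ∀ (j k : ℤ), symbWD g (i - i1) j k = 0 := by
      intro j k
      simp only [symbWD]
      rw [if_neg (by omega)]
    simp [this, DpIt_zero]

theorem expW_eq (n M : ℕ) (hM : n < M) (g : ℤ → V) (j : ℤ) :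
    expW n g j = ∑ m ∈ Finset.range M, ∑ a ∈ Finset.range M,
      ((n.choose a * (n - a).choose m : ℕ) : ℂ) •
      ((Polynomial.X : Polynomial V) ^ (n - a - m) * Polynomial.C (Dit m (g (j - (a : ℤ))))) := by
  unfold expW
  rw [finsum_rng _ M]
  · apply Finset.sum_congr rfl
    intro m _
    rw [finsum_rng _ M]
    · apply Finset.sum_congr rfl
      intro a _
      rw [choose_symm2 n a m]
      split_ifs with h
      · congr 3
        omega
      · rw [tri_zero _ _ _ (by omega)]
        simp
    · intro k hk
      rw [if_neg (by omega)]
  · intro k hk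
    apply finsum_z
    intro a
    rw [if_neg (by omega)]

theorem partB {f g : ℤ → V} {N : ℕ} (hf : IsDiffOpLE f N) (hg : IsDiffOpLE g N) (i j : ℤ) :
    iotaTermB f g i j = omul (omul (symbZ f) iotaZInv) (symbWD g) i j 0 := by
  rw [partB_rhs f hg]
  obtain ⟨M, hM⟩ : ∃ M : ℕ, ∀ n : ℕ, M ≤ n → f (i + n + 1) = 0 := by
    refine ⟨N + i.natAbs, fun n hn => f_big hf _ ?_⟩
    omega
  have hF : ∀ a k : ℕ, omul (symbZ f) iotaZInv i a k = ∑ n ∈ Finset.range M,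
      Polynomial.C (f (i + n + 1)) * (((n.choose a * (n - a).choose k : ℕ) : ℂ) •
        (Polynomial.X : Polynomial V) ^ (n - a - k)) := by
    intro a k
    rw [omulB_eq, finsum_rng _ M]
    · simp only [iota_nat]
    · intro n hn
      simp [hM n hn]
  have hF0 : ∀ a k : ℕ, M ≤ a ∨ M ≤ k → omul (symbZ f) iotaZInv i a k = 0 := by
    intro a k h
    rw [hF]
    apply Finset.sum_eq_zero
    intro n hn
    rw [Finset.mem_range] at hn
    rw [tri_zero _ _ _ (by omega)]
    simp
  unfold iotaTermB
  rw [finsum_rng _ M]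
  · rw [finsum_rng _ M]
    · rw [Finset.sum_congr rfl fun (a : ℕ) _ => finsum_rng
        (fun k : ℕ => omul (symbZ f) iotaZInv i a k * Polynomial.C (Dit k (g (j - a)))) M
        (fun k hk => by simp only [hF0 a k (Or.inr hk), zero_mul])]
      simp only [hF, Finset.sum_mul]
      rw [Finset.sum_congr rfl fun a _ => Finset.sum_comm, Finset.sum_comm]
      apply Finset.sum_congr rfl
      intro n hn
      rw [Finset.mem_range] at hn
      rw [expW_eq n M hn, Finset.mul_sum, Finset.sum_comm (s := Finset.range M)]
      apply Finset.sum_congr rfl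
      intro m _
      rw [Finset.mul_sum]
      apply Finset.sum_congr rfl
      intro a _
      simp only [mul_smul_comm, smul_mul_assoc, mul_assoc]
    · intro a ha
      simp [hF0 a _ (Or.inl ha)]
  · intro n hn
    simp [hM n hn]

end

end PDO

/-- For differential operators `A, B` of order at most `N`,
`A(z) ι_z(z-w-λ-∂)⁻¹(B(w)) - A(∂+λ+w) ι_z(z-w-λ-∂)⁻¹(B*(λ-z))`
equals `(A(z)(z-w-λ-∂)⁻¹ B(∂+w) - A(∂+λ+w)(z-w-λ-∂)⁻¹ B*(λ-z))(1)`, where `(·)(1)`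
takes the constant (∂⁰) coefficient.  Both sides are written as their coefficient at
`z^i w^j`. -/
theorem lemma_abc_i_eq_ii (V : Type*) [DiffSuperAlg V] (N : ℕ) (f g : ℤ → V)
    (hf : PDO.IsDiffOpLE f N) (hg : PDO.IsDiffOpLE g N) (i j : ℤ) :
    PDO.iotaTermB f g i j - PDO.iotaTermA f g i j =
      PDO.omul (PDO.omul (PDO.symbZ f) PDO.iotaZInv) (PDO.symbWD g) i j 0
      - PDO.omul (PDO.omul (PDO.symbWLD f) PDO.iotaZInv) (PDO.symbAdjLZ g) i j 0 := by
  rw [PDO.partB hf hg, PDO.partA hf]
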